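/- Let x > 0 with x ≠ 1, and for each natural number q define a_q(x) = (2/π)∫_0^π cos((log x/π)·log(tan(z/2)))·cos(qz) dz and b_q(x) = (2/π)∫_0^π sin((log x/π)·log(tan(z/2)))·cos(qz) dz. Then for every q ≥ 1: (log x/π)·a_q(x) = −(((q+1)/2)·b_{q+1}(x) − ((q−1)/2)·b_{q−1}(x)), and moreover (log x/π)·a_0(x) = −b_1(x). -/

import Mathlib

open Real intervalIntegral

/-- The q-th Fourier cosine coefficient of `cos((log x/π) log tan(z/2))` on `[0, π]`. -/
noncomputable def chebA (x : ℝ) (q : ℕ) : ℝ :=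
  (2 / π) * ∫ z in (0 : ℝ)..π,
    Real.cos ((Real.log x / π) * Real.log (Real.tan (z / 2))) * Real.cos (q * z)

/-- The q-th Fourier cosine coefficient of `sin((log x/π) log tan(z/2))` on `[0, π]`. -/
noncomputable def chebB (x : ℝ) (q : ℕ) : ℝ :=
  (2 / π) * ∫ z in (0 : ℝ)..π,
    Real.sin ((Real.log x / π) * Real.log (Real.tan (z / 2))) * Real.cos (q * z)

open Set Filter Topology MeasureTheory

theorem measurable_log_tan_half : Measurable fun z : ℝ => Real.log (Real.tan (z / 2)) := by
  simp only [Real.tan_eq_sin_div_cos]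
  fun_prop

theorem hasDerivAt_log_tan_half {z : ℝ} (hz : z ∈ Ioo 0 π) :
    HasDerivAt (fun z : ℝ => Real.log (Real.tan (z / 2))) (1 / Real.sin z) z := by
  have hs : 0 < Real.sin (z / 2) :=
    Real.sin_pos_of_pos_of_lt_pi (by linarith [hz.1]) (by linarith [hz.1, hz.2])
  have hc : 0 < Real.cos (z / 2) :=
    Real.cos_pos_of_mem_Ioo ⟨by linarith [hz.1, hz.2], by linarith [hz.2]⟩
  have ht : Real.tan (z / 2) ≠ 0 := by
    rw [Real.tan_eq_sin_div_cos]
    positivity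
  have h := ((Real.hasDerivAt_tan hc.ne').comp z ((hasDerivAt_id' z).div_const 2)).log
    (by simpa using ht)
  refine h.congr_deriv ?_
  have hz2 : Real.sin z = 2 * Real.sin (z / 2) * Real.cos (z / 2) := by
    rw [← Real.sin_two_mul]
    ring_nf
  simp only [Function.comp_apply]
  rw [hz2, Real.tan_eq_sin_div_cos]
  field_simp

theorem intervalIntegrable_of_measurable_of_abs_le {f : ℝ → ℝ} (hf : Measurable f) (C : ℝ)
    (hC : ∀ z, |f z| ≤ C) (a b : ℝ) : IntervalIntegrable f volume a b := by
  rw [intervalIntegrable_iff]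
  exact Measure.integrableOn_of_bounded (by simp) hf.aestronglyMeasurable
    (Eventually.of_forall hC)

theorem abs_mul_le_one {a b : ℝ} (ha : |a| ≤ 1) (hb : |b| ≤ 1) : |a * b| ≤ 1 := by
  rw [abs_mul]
  exact mul_le_one₀ ha (abs_nonneg b) hb

theorem intervalIntegrable_cos_log_tan_half_mul_cos (c r a b : ℝ) :
    IntervalIntegrable
      (fun z => Real.cos (c * Real.log (Real.tan (z / 2))) * Real.cos (r * z)) volume a b := by
  have := measurable_log_tan_half
  exact intervalIntegrable_of_measurable_of_abs_le (by fun_prop) 1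
    (fun z => abs_mul_le_one (abs_cos_le_one _) (abs_cos_le_one _)) a b

theorem intervalIntegrable_sin_log_tan_half_mul_cos (c r a b : ℝ) :
    IntervalIntegrable
      (fun z => Real.sin (c * Real.log (Real.tan (z / 2))) * Real.cos (r * z)) volume a b := by
  have := measurable_log_tan_half
  exact intervalIntegrable_of_measurable_of_abs_le (by fun_prop) 1
    (fun z => abs_mul_le_one (abs_sin_le_one _) (abs_cos_le_one _)) a b

theorem tendsto_sin_log_tan_half_mul_sin_mul_cos (c r : ℝ) {p : ℝ} (hp : Real.sin p = 0) :
    Tendsto (fun z => Real.sin (c * Real.log (Real.tan (z / 2))) * Real.cos (r * z) * Real.sin z)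
      (𝓝 p) (𝓝 0) := by
  have h : Tendsto (fun z => |Real.sin z|) (𝓝 p) (𝓝 0) := by
    simpa [hp] using (Real.continuous_sin.abs.tendsto p)
  refine squeeze_zero_norm (fun z => ?_) h
  rw [Real.norm_eq_abs, abs_mul]
  exact mul_le_of_le_one_left (abs_nonneg _)
    (abs_mul_le_one (abs_sin_le_one _) (abs_cos_le_one _))

theorem mul_integral_cos_log_tan_half_mul_cos (c r : ℝ) :
    c * ∫ z in (0 : ℝ)..π, Real.cos (c * Real.log (Real.tan (z / 2))) * Real.cos (r * z) =
      -(((r + 1) / 2) *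
          (∫ z in (0 : ℝ)..π,
            Real.sin (c * Real.log (Real.tan (z / 2))) * Real.cos ((r + 1) * z)) -
        ((r - 1) / 2) *
          ∫ z in (0 : ℝ)..π,
            Real.sin (c * Real.log (Real.tan (z / 2))) * Real.cos ((r - 1) * z)) := by
  have i₁ := (intervalIntegrable_cos_log_tan_half_mul_cos c r 0 π).const_mul c
  have i₂ := (intervalIntegrable_sin_log_tan_half_mul_cos c (r + 1) 0 π).const_mul ((r + 1) / 2)
  have i₃ := (intervalIntegrable_sin_log_tan_half_mul_cos c (r - 1) 0 π).const_mul ((r - 1) / 2)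
  have key := integral_eq_sub_of_hasDerivAt_of_tendsto (a := 0) (b := π) Real.pi_pos
    (f := fun z =>
      Real.sin (c * Real.log (Real.tan (z / 2))) * Real.cos (r * z) * Real.sin z)
    (fun z hz => ?_) (i₁.add (i₂.sub i₃))
    ((tendsto_sin_log_tan_half_mul_sin_mul_cos c r Real.sin_zero).mono_left nhdsWithin_le_nhds)
    ((tendsto_sin_log_tan_half_mul_sin_mul_cos c r Real.sin_pi).mono_left nhdsWithin_le_nhds)
  · rw [integral_add i₁ (i₂.sub i₃), integral_sub i₂ i₃] at key
    simp only [intervalIntegral.integral_const_mul] at key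
    linarith
  · have hs : Real.sin z ≠ 0 := (Real.sin_pos_of_mem_Ioo hz).ne'
    have h := ((((hasDerivAt_log_tan_half hz).const_mul c).sin).mul
      (((hasDerivAt_id z).const_mul r).cos)).mul (Real.hasDerivAt_sin z)
    refine h.congr_deriv ?_
    simp only [id_eq, Pi.mul_apply]
    rw [show (r + 1) * z = r * z + z by ring, show (r - 1) * z = r * z - z by ring,
      Real.cos_add, Real.cos_sub]
    field_simp
    ring

theorem chebyshev_recurrence_a (x : ℝ) (hx : 0 < x) (hx1 : x ≠ 1) :
    (∀ q : ℕ, 1 ≤ q →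
        (Real.log x / π) * chebA x q =
          -((((q : ℝ) + 1) / 2) * chebB x (q + 1) - (((q : ℝ) - 1) / 2) * chebB x (q - 1))) ∧
      (Real.log x / π) * chebA x 0 = -chebB x 1 := by
  refine ⟨fun q hq => ?_, ?_⟩
  · have h := mul_integral_cos_log_tan_half_mul_cos (Real.log x / π) q
    simp only [chebA, chebB]
    push_cast [Nat.cast_sub hq]
    linear_combination (2 / π) * h
  · have h := mul_integral_cos_log_tan_half_mul_cos (Real.log x / π) 0
    simp only [zero_add, zero_sub, neg_mul, Real.cos_neg] at h
    simp only [chebA, chebB, Nat.cast_zero, Nat.cast_one]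
    linear_combination (2 / π) * h
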